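/- For every integer n ≥ 0, the number of lattice paths of length 2n that stay in the strip [-2, 1] and end at height 0 equals the Fibonacci number F(2n+1). -/

import Mathlib

/-- The height of a lattice path `s : Fin n → ℤ` after `j` steps:
the sum of the first `j` steps. -/
def pathHeight {n : ℕ} (s : Fin n → ℤ) (j : ℕ) : ℤ :=
  ∑ i ∈ Finset.univ.filter (fun i : Fin n => (i : ℕ) < j), s i

/-- The number of lattice paths of length `n` (steps `±1`) whose height stays in
`[a, b]` at every time `0 ≤ j ≤ n` and whose final height lies in `E`. -/
noncomputable def pathCount (n : ℕ) (a b : ℤ) (E : Set ℤ) : ℕ :=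
  Nat.card {s : Fin n → ℤ //
    (∀ i, s i ∈ ({1, -1} : Set ℤ)) ∧
    (∀ j ≤ n, pathHeight s j ∈ Set.Icc a b) ∧
    pathHeight s n ∈ E}

theorem pathHeight_snoc_of_le {n : ℕ} (s : Fin n → ℤ) (x : ℤ) {j : ℕ} (hj : j ≤ n) :
    pathHeight (Fin.snoc s x : Fin (n + 1) → ℤ) j = pathHeight s j := by
  have hn : ¬ n < j := by omega
  simp [pathHeight, Finset.sum_filter, Fin.sum_univ_castSucc, hn]

theorem pathHeight_snoc_last {n : ℕ} (s : Fin n → ℤ) (x : ℤ) :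
    pathHeight (Fin.snoc s x : Fin (n + 1) → ℤ) (n + 1) = pathHeight s n + x := by
  simp [pathHeight, Finset.sum_filter, Fin.sum_univ_castSucc]

/-- The lattice paths of length `n` in the strip `[a, b]` that end at height `m`. -/
def stripPaths (n : ℕ) (a b m : ℤ) : Set (Fin n → ℤ) :=
  {s | (∀ i, s i ∈ ({1, -1} : Set ℤ)) ∧
    (∀ j ≤ n, pathHeight s j ∈ Set.Icc a b) ∧ pathHeight s n ∈ ({m} : Set ℤ)}

theorem pathCount_eq_ncard_stripPaths (n : ℕ) (a b m : ℤ) :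
    pathCount n a b {m} = (stripPaths n a b m).ncard := rfl

theorem finite_stripPaths (n : ℕ) (a b m : ℤ) : (stripPaths n a b m).Finite :=
  (Set.Finite.pi' fun _ : Fin n => Set.toFinite ({1, -1} : Set ℤ)).subset fun _ hs => hs.1

theorem snoc_mem_stripPaths_iff {n : ℕ} {a b m : ℤ} (hm : m ∈ Set.Icc a b)
    (s : Fin n → ℤ) (x : ℤ) :
    (Fin.snoc s x : Fin (n + 1) → ℤ) ∈ stripPaths (n + 1) a b m ↔
      (x = 1 ∨ x = -1) ∧ s ∈ stripPaths n a b (m - x) := by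
  simp only [stripPaths, Set.mem_ofPred_eq, Fin.forall_fin_succ', Fin.snoc_castSucc,
    Fin.snoc_last, pathHeight_snoc_last, Set.mem_singleton_iff, Set.mem_insert_iff]
  constructor
  · rintro ⟨⟨hs, hx⟩, hstrip, hend⟩
    refine ⟨hx, hs, fun j hj => ?_, by omega⟩
    rw [← pathHeight_snoc_of_le s x hj]
    exact hstrip j (by omega)
  · rintro ⟨hx, hs, hstrip, hend⟩
    refine ⟨⟨hs, hx⟩, fun j hj => ?_, by omega⟩
    rcases Nat.le_succ_iff.mp hj with hj | rfl
    · rw [pathHeight_snoc_of_le s x hj]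
      exact hstrip j hj
    · rw [Nat.succ_eq_add_one, pathHeight_snoc_last, hend]
      simpa using hm

theorem pathCount_succ (n : ℕ) {a b m : ℤ} (hm : m ∈ Set.Icc a b) :
    pathCount (n + 1) a b {m} = pathCount n a b {m - 1} + pathCount n a b {m + 1} := by
  let f (x : ℤ) (s : Fin n → ℤ) : Fin (n + 1) → ℤ := Fin.snoc s x
  have hf (x : ℤ) : Function.Injective (f x) := fun s t h => (Fin.snoc_inj.mp h).1
  have hunion : stripPaths (n + 1) a b m =
      f 1 '' stripPaths n a b (m - 1) ∪ f (-1) '' stripPaths n a b (m + 1) := by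
    ext s
    constructor
    · intro hs
      rw [← Fin.snoc_init_self s, snoc_mem_stripPaths_iff hm] at hs
      obtain ⟨hx | hx, hs⟩ := hs
      · exact Or.inl ⟨Fin.init s, by simpa [hx] using hs, by simp [f, ← hx]⟩
      · exact Or.inr ⟨Fin.init s, by simpa [hx] using hs, by simp [f, ← hx]⟩
    · rintro (⟨t, ht, rfl⟩ | ⟨t, ht, rfl⟩)
      · exact (snoc_mem_stripPaths_iff hm t 1).mpr ⟨Or.inl rfl, ht⟩
      · exact (snoc_mem_stripPaths_iff hm t (-1)).mpr ⟨Or.inr rfl, by simpa using ht⟩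
  have hdisj : Disjoint (f 1 '' stripPaths n a b (m - 1))
      (f (-1) '' stripPaths n a b (m + 1)) := by
    rw [Set.disjoint_left]
    rintro _ ⟨s, -, rfl⟩ ⟨t, -, h⟩
    have := (Fin.snoc_inj.mp h).2
    omega
  simp only [pathCount_eq_ncard_stripPaths]
  rw [hunion, Set.ncard_union_eq hdisj ((finite_stripPaths ..).image _)
    ((finite_stripPaths ..).image _), Set.ncard_image_of_injective _ (hf _),
    Set.ncard_image_of_injective _ (hf _)]

theorem pathCount_eq_zero (n : ℕ) {a b m : ℤ} (hm : m ∉ Set.Icc a b) :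
    pathCount n a b {m} = 0 := by
  rw [pathCount_eq_ncard_stripPaths, Set.ncard_eq_zero (finite_stripPaths ..),
    Set.eq_empty_iff_forall_notMem]
  rintro s ⟨-, hstrip, hend⟩
  exact hm (hend ▸ hstrip n le_rfl)

theorem pathCount_zero_singleton_zero {a b : ℤ} (h : (0 : ℤ) ∈ Set.Icc a b) :
    pathCount 0 a b {0} = 1 := by
  rw [pathCount_eq_ncard_stripPaths, Set.ncard_eq_one]
  refine ⟨Fin.elim0, Set.eq_singleton_iff_unique_mem.mpr ⟨?_, fun _ _ => Subsingleton.elim _ _⟩⟩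
  simpa [stripPaths, pathHeight] using h

theorem pathCount_zero_of_ne {a b m : ℤ} (hm : m ≠ 0) : pathCount 0 a b {m} = 0 := by
  rw [pathCount_eq_ncard_stripPaths, Set.ncard_eq_zero (finite_stripPaths ..),
    Set.eq_empty_iff_forall_notMem]
  rintro s ⟨-, -, hend⟩
  exact hm (by simpa [pathHeight] using hend.symm)

theorem pathCount_two_mul_eq_fib (n : ℕ) :
    pathCount (2 * n) (-2) 1 {0} = Nat.fib (2 * n + 1) ∧
      pathCount (2 * n) (-2) 1 {-2} = Nat.fib (2 * n) := by
  induction n with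
  | zero =>
    exact ⟨pathCount_zero_singleton_zero (by simp), pathCount_zero_of_ne (by simp)⟩
  | succ n ih =>
    obtain ⟨h0, h2⟩ := ih
    have hpos : pathCount (2 * n + 1) (-2) 1 {1} = Nat.fib (2 * n + 1) := by
      rw [pathCount_succ _ (by simp), pathCount_eq_zero (m := 1 + 1) _ (by simp)]
      simpa using h0
    have hneg : pathCount (2 * n + 1) (-2) 1 {-1} = Nat.fib (2 * n + 2) := by
      rw [pathCount_succ _ (by simp), Nat.fib_add_two, ← h0, ← h2]
      norm_num
    rw [show 2 * (n + 1) = 2 * n + 1 + 1 by ring]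
    constructor
    · rw [pathCount_succ _ (by simp), Nat.fib_add_two, ← hpos, ← hneg]
      norm_num [add_comm]
    · rw [pathCount_succ _ (by simp), pathCount_eq_zero (m := -2 - 1) _ (by simp), ← hneg]
      norm_num

theorem stmt_14 (n : ℕ) :
    pathCount (2 * n) (-2) 1 ({0} : Set ℤ) = Nat.fib (2 * n + 1) := by
  exact (pathCount_two_mul_eq_fib n).1
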